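/- arXiv:2605.19475 — 2 statements merged into one kernel-verified Lean document; each statement's English description precedes it below -/
import Mathlib

section
/- Let a, ρ ∈ ℂ. For i ∈ ℕ define sᵢ(x) = (x+a)ᵢ and cₗ(x) = (ρ−x)ₗ, where (z)ₘ denotes the Pochhammer symbol. Then for every i ∈ ℕ and all x ∈ ℂ, sᵢ(x) = Σ_{ℓ=0}^{i} (−1)^ℓ · binom(i, ℓ) · (ℓ+a+ρ)_{i−ℓ} · cₗ(x), where binom denotes the ordinary binomial coefficient. -/
/-- The Pochhammer symbol `(z)ₘ = z (z+1) ⋯ (z+m-1)`. -/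
noncomputable def poch (z : ℂ) (m : ℕ) : ℂ := ∏ i ∈ Finset.range m, (z + i)

/-- The split basis `sᵢ(x) = (x+a)ᵢ`. -/
noncomputable def sFun (a : ℂ) (i : ℕ) (x : ℂ) : ℂ := poch (x + a) i

/-- The basis `cₗ(x) = (ρ-x)ₗ`. -/
noncomputable def cFun (ρ : ℂ) (l : ℕ) (x : ℂ) : ℂ := poch (ρ - x) l

theorem poch_succ (z : ℂ) (m : ℕ) : poch z (m + 1) = poch z m * (z + m) :=
  Finset.prod_range_succ _ _

theorem poch_succ_left (z : ℂ) (m : ℕ) : poch z (m + 1) = z * poch (z + 1) m := by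
  simp only [poch, Finset.prod_range_succ']
  rw [mul_comm]
  push_cast
  simp only [add_zero, add_assoc, add_comm (1 : ℂ)]

/-- The Chu–Vandermonde identity for Pochhammer symbols of a difference. -/
theorem poch_sub (b y : ℂ) (i : ℕ) :
    poch (b - y) i = ∑ l ∈ Finset.range (i + 1),
      (i.choose l : ℂ) * ((-1) ^ l * poch (b + l) (i - l) * poch y l) := by
  induction i generalizing b with
  | zero => simp [poch]
  | succ i ih =>
    rw [Finset.sum_choose_succ_mul (fun l m => (-1 : ℂ) ^ l * poch (b + l) m * poch y l),
      ← Finset.sum_add_distrib, poch_succ_left, show b - y + 1 = b + 1 - y by ring, ih,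
      Finset.mul_sum]
    refine Finset.sum_congr rfl fun l hl => ?_
    rw [Nat.succ_sub (Finset.mem_range_succ_iff.mp hl), Nat.succ_eq_add_one,
      poch_succ_left (b + l), poch_succ y l]
    push_cast
    rw [show b + l + 1 = b + 1 + (l : ℂ) by ring, show b + (l + 1) = b + 1 + (l : ℂ) by ring]
    ring

/-- Connection formula: `sᵢ = Σ_{ℓ=0}^{i} (-1)^ℓ binom(i, ℓ) (ℓ+a+ρ)_{i-ℓ} cₗ`. -/
theorem s_in_terms_of_c (a ρ : ℂ) (i : ℕ) (x : ℂ) :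
    sFun a i x =
      ∑ l ∈ Finset.range (i + 1),
        (-1 : ℂ) ^ l * (Nat.choose i l : ℂ) * poch ((l : ℂ) + a + ρ) (i - l)
          * cFun ρ l x := by
  rw [sFun, show x + a = a + ρ - (ρ - x) by ring, poch_sub]
  refine Finset.sum_congr rfl fun l _ => ?_
  rw [cFun, show a + ρ + l = (l : ℂ) + a + ρ by ring]
  ring
end

section
/- Let a, ρ ∈ ℂ and N ∈ ℕ with N ≥ 1, and assume (a+ρ)ⱼ ≠ 0 for all 0 ≤ j ≤ N, (k+2a−1)_{N+1} ≠ 0 for all 0 ≤ k ≤ N, and 2n+2a−1 ≠ 0 for all 0 ≤ n ≤ N. For 0 ≤ k ≤ N and ℓ ∈ ℕ define the Hahn polynomial value Qₖ(ℓ) = Σ_{j=0}^{k} [ (−k)ⱼ · (−ℓ)ⱼ · (k+2a−1)ⱼ ] / [ (a+ρ)ⱼ · (−N)ⱼ · j! ]. Then the Hahn polynomials satisfy the orthogonality relation: for all 0 ≤ m, n ≤ N, Σ_{ℓ=0}^{N} [ (a+ρ)ₗ / ℓ! ] · [ (a−ρ)_{N−ℓ} / (N−ℓ)! ] · Q_m(ℓ)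 · Q_n(ℓ) = δ_{m,n} · [ (−1)^n · n! · (n+2a−1)_{N+1} · (a−ρ)ₙ ] / [ (2n+2a−1) · (a+ρ)ₙ · (−N)ₙ · N! ], where δ_{m,n} is the Kronecker delta. -/
/-- The Hahn polynomial
`Qₖ(ℓ) = ₃F₂(-k, -ℓ, k+2a-1 ; a+ρ, -N ; 1)
       = Σ_{j=0}^{k} (-k)ⱼ (-ℓ)ⱼ (k+2a-1)ⱼ / ((a+ρ)ⱼ (-N)ⱼ j!)`. -/
noncomputable def hahnQ (a ρ : ℂ) (N k l : ℕ) : ℂ :=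
  ∑ j ∈ Finset.range (k + 1),
    (poch (-(k : ℂ)) j * poch (-(l : ℂ)) j * poch ((k : ℂ) + 2 * a - 1) j) /
      (poch (a + ρ) j * poch (-(N : ℂ)) j * (Nat.factorial j : ℂ))

theorem poch_zero (z : ℂ) : poch z 0 = 1 := by simp [poch]

theorem poch_add (z : ℂ) (m k : ℕ) : poch z (m + k) = poch z m * poch (z + m) k := by
  simp only [poch, Finset.prod_range_add]
  congr 1
  exact Finset.prod_congr rfl fun i _ => by push_cast; ring

theorem poch_reflect (z : ℂ) (m : ℕ) : poch z m = (-1) ^ m * poch (1 - z - m) m := by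
  simp only [poch]
  rw [← Finset.prod_range_reflect, ← Finset.card_range m, ← Finset.prod_const,
    Finset.card_range, ← Finset.prod_mul_distrib]
  refine Finset.prod_congr rfl fun i hi => ?_
  rw [Nat.sub_sub, Nat.cast_sub (by have := Finset.mem_range.1 hi; omega)]
  push_cast
  ring

theorem poch_one (m : ℕ) : poch 1 m = (Nat.factorial m : ℂ) := by
  induction m with
  | zero => simp [poch_zero]
  | succ m ih => rw [poch_succ, ih, Nat.factorial_succ]; push_cast; ring

theorem poch_neg_eq_zero {l j : ℕ} (h : l < j) : poch (-(l : ℂ)) j = 0 :=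
  Finset.prod_eq_zero (Finset.mem_range.2 h) (by simp)

theorem poch_neg_mul_factorial (j k : ℕ) :
    poch (-((j + k : ℕ) : ℂ)) j * (Nat.factorial k : ℂ)
      = (-1) ^ j * (Nat.factorial (j + k) : ℂ) := by
  rw [poch_reflect, ← poch_one, ← poch_one, Nat.add_comm j k, poch_add 1 k j]
  push_cast
  rw [show (1 : ℂ) - -(k + j) - j = 1 + k by ring]
  ring

theorem poch_neg_natCast_ne_zero {j N : ℕ} (h : j ≤ N) : poch (-(N : ℂ)) j ≠ 0 := by
  obtain ⟨k, rfl⟩ := Nat.exists_eq_add_of_le h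
  intro h0
  have := poch_neg_mul_factorial j k
  rw [h0, zero_mul] at this
  exact mul_ne_zero (pow_ne_zero _ (by norm_num)) (by exact_mod_cast Nat.factorial_ne_zero _)
    this.symm

/-- The Chu–Vandermonde identity for Pochhammer symbols. -/
theorem poch_add_eq_sum (x y : ℂ) (n : ℕ) :
    poch (x + y) n
      = ∑ i ∈ Finset.range (n + 1), (n.choose i : ℂ) * (poch x i * poch y (n - i)) := by
  rw [← Finset.Nat.sum_antidiagonal_eq_sum_range_succ
    (fun i j => (n.choose i : ℂ) * (poch x i * poch y j))]
  induction n with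
  | zero => simp [poch_zero]
  | succ n ih =>
    rw [Finset.sum_antidiagonal_choose_succ_mul (fun i j => poch x i * poch y j),
      ← Finset.sum_add_distrib, poch_succ, ih, Finset.sum_mul]
    refine Finset.sum_congr rfl fun p hp => ?_
    have hp' : p.1 + p.2 = n := Finset.HasAntidiagonal.mem_antidiagonal.1 hp
    have hc : n.choose p.2 = n.choose p.1 := by
      rw [← hp', Nat.choose_symm_add]
    rw [hc, poch_succ, poch_succ, ← hp']
    push_cast
    ring

theorem sum_poch_div_factorial (x y : ℂ) (n : ℕ) :
    ∑ l ∈ Finset.range (n + 1), poch x l / (Nat.factorial l : ℂ)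
        * (poch y (n - l) / (Nat.factorial (n - l) : ℂ))
      = poch (x + y) n / (Nat.factorial n : ℂ) := by
  rw [poch_add_eq_sum, Finset.sum_div]
  refine Finset.sum_congr rfl fun l hl => ?_
  rw [Nat.cast_choose ℂ (Finset.mem_range_succ_iff.1 hl)]
  have := Nat.factorial_ne_zero n
  have := Nat.factorial_ne_zero l
  have := Nat.factorial_ne_zero (n - l)
  field_simp

theorem sum_neg_one_pow_choose_poch (x y : ℂ) (n : ℕ) :
    ∑ j ∈ Finset.range (n + 1),
        (-1) ^ j * (n.choose j : ℂ) * (poch x j * poch (y + j) (n - j))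
      = poch (y - x) n := by
  rw [poch_reflect (y - x), show 1 - (y - x) - (n : ℂ) = x + (1 - y - n) by ring,
    poch_add_eq_sum, Finset.mul_sum]
  refine Finset.sum_congr rfl fun j hj => ?_
  have hj' := Finset.mem_range_succ_iff.1 hj
  rw [poch_reflect (y + j) (n - j), Nat.cast_sub hj',
    show 1 - (y + j) - ((n : ℂ) - j) = 1 - y - n by ring]
  obtain ⟨k, rfl⟩ := Nat.exists_eq_add_of_le hj'
  rw [Nat.add_sub_cancel_left, pow_add]
  ring

/-- The factorial moments of the Hahn weight. -/
theorem sum_weight_mul_poch_neg (x y : ℂ) {N j : ℕ} (hj : j ≤ N) :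
    ∑ l ∈ Finset.range (N + 1), poch x l / (Nat.factorial l : ℂ)
        * (poch y (N - l) / (Nat.factorial (N - l) : ℂ)) * poch (-(l : ℂ)) j
      = poch x j * poch (-(N : ℂ)) j / (Nat.factorial N : ℂ) * poch (x + y + j) (N - j) := by
  obtain ⟨M, rfl⟩ := Nat.exists_eq_add_of_le hj
  rw [Nat.add_assoc, Finset.sum_range_add, Finset.sum_eq_zero, zero_add, Nat.add_sub_cancel_left,
    show x + y + j = (x + j) + y by ring]
  · have hM : poch (x + j + y) M = poch (x + j + y) M / (Nat.factorial M : ℂ)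
        * (Nat.factorial M : ℂ) := by
      have : (Nat.factorial M : ℂ) ≠ 0 := by exact_mod_cast Nat.factorial_ne_zero _
      field_simp
    have hN : ((Nat.factorial (j + M) : ℕ) : ℂ) ≠ 0 := by
      exact_mod_cast Nat.factorial_ne_zero _
    rw [hM, ← sum_poch_div_factorial, mul_comm _ (Nat.factorial M : ℂ), ← mul_assoc,
      Finset.mul_sum]
    refine Finset.sum_congr rfl fun k hk => ?_
    have e := poch_neg_mul_factorial j M
    have e' := poch_neg_mul_factorial j k
    have hk0 : (Nat.factorial k : ℂ) ≠ 0 := by exact_mod_cast Nat.factorial_ne_zero _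
    have hjk : ((Nat.factorial (j + k) : ℕ) : ℂ) ≠ 0 := by
      exact_mod_cast Nat.factorial_ne_zero _
    have hL : poch (-((j + k : ℕ) : ℂ)) j
        = (-1) ^ j * (Nat.factorial (j + k) : ℂ) / (Nat.factorial k : ℂ) := by
      rw [← e']; field_simp
    have hR : poch x j * poch (-((j + M : ℕ) : ℂ)) j / (Nat.factorial (j + M) : ℂ)
        * (Nat.factorial M : ℂ) = poch x j * (-1) ^ j := by
      rw [div_mul_eq_mul_div, mul_assoc, e]; field_simp
    rw [hR, hL, poch_add x j k, Nat.add_sub_add_left]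
    field_simp
  · intro l hl
    rw [poch_neg_eq_zero (Finset.mem_range.1 hl), mul_zero]

theorem poch_neg_div_factorial (n j : ℕ) (hj : j ≤ n) :
    poch (-(n : ℂ)) j / (Nat.factorial j : ℂ) = (-1) ^ j * (n.choose j : ℂ) := by
  obtain ⟨k, rfl⟩ := Nat.exists_eq_add_of_le hj
  have e := poch_neg_mul_factorial j k
  have hk0 : (Nat.factorial k : ℂ) ≠ 0 := by exact_mod_cast Nat.factorial_ne_zero _
  have hj0 : (Nat.factorial j : ℂ) ≠ 0 := by exact_mod_cast Nat.factorial_ne_zero _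
  rw [Nat.cast_choose ℂ hj, Nat.add_sub_cancel_left, ← mul_div_assoc, ← e]
  field_simp

/-- Pairing of a Hahn polynomial with `(a - ρ + N - ℓ)ᵢ` against the weight. -/
theorem sum_weight_mul_poch_mul_hahnQ (a ρ : ℂ) {N n : ℕ} (i : ℕ) (hn : n ≤ N)
    (h1 : ∀ j ≤ N, poch (a + ρ) j ≠ 0) :
    ∑ l ∈ Finset.range (N + 1), poch (a + ρ) l / (Nat.factorial l : ℂ)
        * (poch (a - ρ) (N - l) / (Nat.factorial (N - l) : ℂ))
        * poch (a - ρ + N - l) i * hahnQ a ρ N n l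
      = poch (a - ρ) i / (Nat.factorial N : ℂ)
        * (poch (2 * a + i + n) (N - n) * poch (i + 1 - n) n) := by
  have hw : ∀ l ∈ Finset.range (N + 1), poch (a + ρ) l / (Nat.factorial l : ℂ)
        * (poch (a - ρ) (N - l) / (Nat.factorial (N - l) : ℂ))
        * poch (a - ρ + N - l) i * hahnQ a ρ N n l
      = ∑ j ∈ Finset.range (n + 1), poch (a - ρ) i *
          (poch (-(n : ℂ)) j * poch ((n : ℂ) + 2 * a - 1) j /
            (poch (a + ρ) j * poch (-(N : ℂ)) j * (Nat.factorial j : ℂ)))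
          * (poch (a + ρ) l / (Nat.factorial l : ℂ)
          * (poch (a - ρ + i) (N - l) / (Nat.factorial (N - l) : ℂ)) * poch (-(l : ℂ)) j) := by
    intro l hl
    have h : poch (a - ρ) (N - l) * poch (a - ρ + N - l) i
        = poch (a - ρ) i * poch (a - ρ + i) (N - l) := by
      rw [← poch_add, Nat.add_comm, poch_add, Nat.cast_sub (Finset.mem_range_succ_iff.1 hl),
        add_sub_assoc]
    rw [hahnQ, Finset.mul_sum]
    refine Finset.sum_congr rfl fun j _ => ?_
    linear_combination (poch (a + ρ) l / (Nat.factorial l : ℂ) / (Nat.factorial (N - l) : ℂ)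
      * ((poch (-(n : ℂ)) j * poch (-(l : ℂ)) j * poch ((n : ℂ) + 2 * a - 1) j) /
      (poch (a + ρ) j * poch (-(N : ℂ)) j * (Nat.factorial j : ℂ)))) * h
  rw [Finset.sum_congr rfl hw, Finset.sum_comm,
    show (i : ℂ) + 1 - n = (2 * a + i) - (n + 2 * a - 1) by ring,
    ← sum_neg_one_pow_choose_poch (n + 2 * a - 1), Finset.mul_sum, Finset.mul_sum]
  refine Finset.sum_congr rfl fun j hj => ?_
  have hjn := Finset.mem_range_succ_iff.1 hj
  have hjN := hjn.trans hn
  rw [← Finset.mul_sum, sum_weight_mul_poch_neg _ _ hjN, ← poch_neg_div_factorial n j hjn,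
    show N - j = (n - j) + (N - n) by omega, poch_add, Nat.cast_sub hjn,
    show a + ρ + (a - ρ + i) + j = 2 * a + i + j by ring,
    show 2 * a + i + j + ((n : ℂ) - j) = 2 * a + i + n by ring]
  have := h1 j hjN
  have := poch_neg_natCast_ne_zero hjN
  have := Nat.factorial_ne_zero j
  field_simp

theorem poch_add_one_sub_eq_zero {i n : ℕ} (h : i < n) : poch ((i : ℂ) + 1 - n) n = 0 := by
  refine Finset.prod_eq_zero (Finset.mem_range.2 (show n - 1 - i < n by omega)) ?_
  rw [Nat.sub_sub, Nat.cast_sub (by omega)]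
  push_cast
  ring

/-- Pairing of a Hahn polynomial with `(-ℓ)ⱼ` against the weight, for `j ≤ n`. -/
theorem sum_weight_mul_poch_neg_mul_hahnQ (a ρ : ℂ) {N n j : ℕ} (hn : n ≤ N) (hj : j ≤ n)
    (h1 : ∀ j ≤ N, poch (a + ρ) j ≠ 0) :
    ∑ l ∈ Finset.range (N + 1), poch (a + ρ) l / (Nat.factorial l : ℂ)
        * (poch (a - ρ) (N - l) / (Nat.factorial (N - l) : ℂ))
        * poch (-(l : ℂ)) j * hahnQ a ρ N n l
      = if j = n then poch (a - ρ) n / (Nat.factorial N : ℂ)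
        * (poch (2 * a + n + n) (N - n) * (Nat.factorial n : ℂ)) else 0 := by
  have hw : ∀ l ∈ Finset.range (N + 1), poch (a + ρ) l / (Nat.factorial l : ℂ)
        * (poch (a - ρ) (N - l) / (Nat.factorial (N - l) : ℂ))
        * poch (-(l : ℂ)) j * hahnQ a ρ N n l
      = ∑ i ∈ Finset.range (j + 1), (j.choose i : ℂ) * poch (-(a - ρ + N)) (j - i) *
        (poch (a + ρ) l / (Nat.factorial l : ℂ)
        * (poch (a - ρ) (N - l) / (Nat.factorial (N - l) : ℂ))
        * poch (a - ρ + N - l) i * hahnQ a ρ N n l) := by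
    intro l _
    rw [show -(l : ℂ) = (a - ρ + N - l) + -(a - ρ + N) by ring,
      poch_add_eq_sum (a - ρ + N - l),
      Finset.mul_sum, Finset.sum_mul]
    exact Finset.sum_congr rfl fun i _ => by ring
  rw [Finset.sum_congr rfl hw, Finset.sum_comm]
  simp only [← Finset.mul_sum, sum_weight_mul_poch_mul_hahnQ a ρ _ hn h1]
  rw [Finset.sum_range_succ, Finset.sum_eq_zero, zero_add]
  · split_ifs with h
    · subst h
      simp [poch_zero, poch_one]
    · rw [poch_add_one_sub_eq_zero (by omega)]
      simp
  · intro i hi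
    rw [poch_add_one_sub_eq_zero ((Finset.mem_range.1 hi).trans_le hj)]
    simp

theorem sum_weight_mul_hahnQ_mul_hahnQ (a ρ : ℂ) {N m n : ℕ} (hn : n ≤ N) (hm : m ≤ n)
    (h1 : ∀ j ≤ N, poch (a + ρ) j ≠ 0) (h3 : 2 * (n : ℂ) + 2 * a - 1 ≠ 0) :
    ∑ l ∈ Finset.range (N + 1),
        (poch (a + ρ) l / (Nat.factorial l : ℂ))
          * (poch (a - ρ) (N - l) / (Nat.factorial (N - l) : ℂ))
          * hahnQ a ρ N m l * hahnQ a ρ N n l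
      = if m = n then
          ((-1 : ℂ) ^ n * (Nat.factorial n : ℂ) * poch ((n : ℂ) + 2 * a - 1) (N + 1)
              * poch (a - ρ) n) /
            ((2 * (n : ℂ) + 2 * a - 1) * poch (a + ρ) n * poch (-(N : ℂ)) n
              * (Nat.factorial N : ℂ))
        else 0 := by
  have hw : ∀ l ∈ Finset.range (N + 1), (poch (a + ρ) l / (Nat.factorial l : ℂ))
          * (poch (a - ρ) (N - l) / (Nat.factorial (N - l) : ℂ))
          * hahnQ a ρ N m l * hahnQ a ρ N n l
      = ∑ j ∈ Finset.range (m + 1), poch (-(m : ℂ)) j * poch ((m : ℂ) + 2 * a - 1) j /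
            (poch (a + ρ) j * poch (-(N : ℂ)) j * (Nat.factorial j : ℂ)) *
        (poch (a + ρ) l / (Nat.factorial l : ℂ)
        * (poch (a - ρ) (N - l) / (Nat.factorial (N - l) : ℂ))
        * poch (-(l : ℂ)) j * hahnQ a ρ N n l) := by
    intro l _
    rw [hahnQ.eq_def a ρ N m l, Finset.mul_sum, Finset.sum_mul]
    exact Finset.sum_congr rfl fun j _ => by ring
  rw [Finset.sum_congr rfl hw, Finset.sum_comm]
  simp only [← Finset.mul_sum]
  rw [Finset.sum_range_succ, Finset.sum_eq_zero, zero_add,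
    sum_weight_mul_poch_neg_mul_hahnQ a ρ hn hm h1]
  · split_ifs with h
    · subst h
      have hp : poch ((m : ℂ) + 2 * a - 1) (N + 1) = poch ((m : ℂ) + 2 * a - 1) m
          * (2 * (m : ℂ) + 2 * a - 1) * poch (2 * a + m + m) (N - m) := by
        rw [show N + 1 = (m + 1) + (N - m) by omega, poch_add, poch_succ]
        push_cast
        congr 2 <;> ring
      have hneg : poch (-(m : ℂ)) m = (-1) ^ m * (Nat.factorial m : ℂ) := by
        simpa using poch_neg_mul_factorial m 0
      have := h1 m hn
      have := poch_neg_natCast_ne_zero hn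
      have := Nat.factorial_ne_zero m
      have := Nat.factorial_ne_zero N
      rw [hp, hneg]
      generalize 2 * (m : ℂ) + 2 * a - 1 = t at h3
      field_simp
    · simp
  · intro j hj
    have hj' := Finset.mem_range.1 hj
    rw [sum_weight_mul_poch_neg_mul_hahnQ a ρ hn (by omega) h1, if_neg (by omega), mul_zero]

/-- Orthogonality of the Hahn polynomials:
`Σ_{ℓ=0}^{N} ((a+ρ)ₗ/ℓ!) ((a-ρ)_{N-ℓ}/(N-ℓ)!) Q_m(ℓ) Q_n(ℓ)
  = δ_{m,n} (-1)^n n! (n+2a-1)_{N+1} (a-ρ)ₙ / ((2n+2a-1) (a+ρ)ₙ (-N)ₙ N!)`. -/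
theorem hahn_orthogonality (a ρ : ℂ) (N : ℕ) (hN : 1 ≤ N)
    (h1 : ∀ j ≤ N, poch (a + ρ) j ≠ 0)
    (h2 : ∀ k ≤ N, poch ((k : ℂ) + 2 * a - 1) (N + 1) ≠ 0)
    (h3 : ∀ n ≤ N, 2 * (n : ℂ) + 2 * a - 1 ≠ 0)
    (m n : ℕ) (hm : m ≤ N) (hn : n ≤ N) :
    ∑ l ∈ Finset.range (N + 1),
        (poch (a + ρ) l / (Nat.factorial l : ℂ))
          * (poch (a - ρ) (N - l) / (Nat.factorial (N - l) : ℂ))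
          * hahnQ a ρ N m l * hahnQ a ρ N n l
      = if m = n then
          ((-1 : ℂ) ^ n * (Nat.factorial n : ℂ) * poch ((n : ℂ) + 2 * a - 1) (N + 1)
              * poch (a - ρ) n) /
            ((2 * (n : ℂ) + 2 * a - 1) * poch (a + ρ) n * poch (-(N : ℂ)) n
              * (Nat.factorial N : ℂ))
        else 0 := by
  rcases le_total m n with h | h
  · exact sum_weight_mul_hahnQ_mul_hahnQ a ρ hn h h1 (h3 n hn)
  · have key := sum_weight_mul_hahnQ_mul_hahnQ a ρ hm h h1 (h3 m hm)
    rw [Finset.sum_congr rfl fun l _ => mul_right_comm _ _ _, key]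
    by_cases e : m = n
    · subst e; rfl
    · rw [if_neg e, if_neg (Ne.symm e)]
end
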